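/- arXiv:2302.06693 — 7 statements merged into one kernel-verified Lean document; each statement's English description precedes it below -/
import Mathlib

section
/- For integers p, q ≥ 1, the space V_{p,q} is the internal direct sum of its subspaces H_{p,q} and ‖z‖²·V_{p−1,q−1}: every f ∈ V_{p,q} can be written uniquely as f = h + ‖z‖²·g with h ∈ H_{p,q} and g ∈ V_{p−1,q−1}. -/
open MvPolynomial

noncomputable section

/-- The polynomial ring `𝒫 = ℂ[z₁,z₂,z̄₁,z̄₂]`, with variables indexed so that
`X 0 = z₁`, `X 1 = z₂`, `X 2 = z̄₁`, `X 3 = z̄₂`. -/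
abbrev P4 : Type := MvPolynomial (Fin 4) ℂ

/-- The Laplacian `Δ = ∂²/∂z₁∂z̄₁ + ∂²/∂z₂∂z̄₂`. -/
def lap (f : P4) : P4 :=
  pderiv (2 : Fin 4) (pderiv (0 : Fin 4) f) + pderiv (3 : Fin 4) (pderiv (1 : Fin 4) f)

/-- The polynomial `‖z‖² = z₁z̄₁ + z₂z̄₂`. -/
def normSqPoly : P4 := X 0 * X 2 + X 1 * X 3

/-- `f` is bihomogeneous of bidegree `(p,q)`: every monomial occurring in it has total
degree `p` in `(z₁,z₂)` and total degree `q` in `(z̄₁,z̄₂)`.  The set of such `f` is `V_{p,q}`. -/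
def IsBihom (p q : ℕ) (f : P4) : Prop :=
  ∀ d ∈ f.support, d 0 + d 1 = p ∧ d 2 + d 3 = q

theorem isBihom_iff (p q : ℕ) (f : P4) : IsBihom p q f ↔
    f.IsWeightedHomogeneous (![1, 1, 0, 0] : Fin 4 → ℕ) p ∧
    f.IsWeightedHomogeneous (![0, 0, 1, 1] : Fin 4 → ℕ) q := by
  have h1 : ∀ d : Fin 4 →₀ ℕ, Finsupp.weight (![1, 1, 0, 0] : Fin 4 → ℕ) d = d 0 + d 1 := by
    intro d
    rw [Finsupp.weight_apply, Finsupp.sum_fintype _ _ (by simp)]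
    simp [Fin.sum_univ_four]
  have h2 : ∀ d : Fin 4 →₀ ℕ, Finsupp.weight (![0, 0, 1, 1] : Fin 4 → ℕ) d = d 2 + d 3 := by
    intro d
    rw [Finsupp.weight_apply, Finsupp.sum_fintype _ _ (by simp)]
    simp [Fin.sum_univ_four]
  constructor
  · intro h
    refine ⟨fun d hd => ?_, fun d hd => ?_⟩
    · rw [h1]; exact (h d (mem_support_iff.2 hd)).1
    · rw [h2]; exact (h d (mem_support_iff.2 hd)).2
  · rintro ⟨ha, hb⟩ d hd
    rw [mem_support_iff] at hd
    exact ⟨by rw [← h1]; exact ha hd, by rw [← h2]; exact hb hd⟩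

theorem IsBihom.sub' {p q : ℕ} {f g : P4} (hf : IsBihom p q f) (hg : IsBihom p q g) :
    IsBihom p q (f - g) := by
  rw [isBihom_iff] at *
  exact ⟨hf.1.sub hg.1, hf.2.sub hg.2⟩

theorem IsBihom.C_mul' {p q : ℕ} {f : P4} (hf : IsBihom p q f) (r : ℂ) :
    IsBihom p q (C r * f) := by
  rw [isBihom_iff] at *
  exact ⟨hf.1.C_mul r, hf.2.C_mul r⟩

theorem IsBihom.normSq_mul {p q : ℕ} {f : P4} (hf : IsBihom p q f) :
    IsBihom (p + 1) (q + 1) (normSqPoly * f) := by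
  rw [isBihom_iff] at *
  have key : ∀ w : Fin 4 → ℕ, w 0 + w 2 = 1 → w 1 + w 3 = 1 →
      (normSqPoly).IsWeightedHomogeneous w 1 := by
    intro w h h'
    refine IsWeightedHomogeneous.add ?_ ?_
    · rw [← h]
      exact (isWeightedHomogeneous_X ℂ w 0).mul (isWeightedHomogeneous_X ℂ w 2)
    · rw [← h']
      exact (isWeightedHomogeneous_X ℂ w 1).mul (isWeightedHomogeneous_X ℂ w 3)
  rw [add_comm p, add_comm q]
  exact ⟨(key _ (by simp) (by simp)).mul hf.1, (key _ (by simp) (by simp)).mul hf.2⟩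

theorem IsBihom.lap_supp {p q : ℕ} {f : P4} (hf : IsBihom p q f) :
    ∀ d ∈ (lap f).support, d 0 + d 1 + 1 = p ∧ d 2 + d 3 + 1 = q := by
  intro d hd
  rw [mem_support_iff, lap, coeff_add] at hd
  simp only [coeff_pderiv] at hd
  by_cases h : coeff (d + Finsupp.single 2 1 + Finsupp.single 0 1) f = 0
  · by_cases h' : coeff (d + Finsupp.single 3 1 + Finsupp.single 1 1) f = 0
    · simp [h, h'] at hd
    · have := hf _ (mem_support_iff.2 h')
      simp [Finsupp.single_apply] at this
      omega
  · have := hf _ (mem_support_iff.2 h)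
    simp [Finsupp.single_apply] at this
    omega

theorem IsBihom.lap' {p q : ℕ} {f : P4} (hf : IsBihom (p + 1) (q + 1) f) :
    IsBihom p q (lap f) := by
  intro d hd
  have := hf.lap_supp d hd
  omega

theorem IsBihom.lap_eq_zero {p q : ℕ} {f : P4} (hf : IsBihom p q f) (h : p = 0 ∨ q = 0) :
    lap f = 0 := by
  rw [← support_eq_empty]
  refine Finset.eq_empty_of_forall_notMem fun d hd => ?_
  have := hf.lap_supp d hd
  omega

theorem lap_sub (f g : P4) : lap (f - g) = lap f - lap g := by
  simp only [lap, map_sub]; ring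

theorem lap_C_mul (r : ℂ) (f : P4) : lap (C r * f) = C r * lap f := by
  simp only [lap, pderiv_C_mul]; ring

theorem lap_normSq {p q : ℕ} {f : P4} (hf : IsBihom p q f) :
    lap (normSqPoly * f) = normSqPoly * lap f + ((p + q + 2 : ℕ) : P4) * f := by
  rw [isBihom_iff] at hf
  have h1 := hf.1.sum_weight_X_mul_pderiv
  have h2 := hf.2.sum_weight_X_mul_pderiv
  simp [Fin.sum_univ_four] at h1 h2
  simp only [lap, normSqPoly, add_mul, map_add, pderiv_mul, pderiv_X, Pi.single_apply]
  simp
  linear_combination h1 + h2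

theorem uniq_aux (a : ℕ) : ∀ (b c : ℕ), 0 < c → ∀ g : P4, IsBihom a b g →
    normSqPoly * lap g + (c : P4) * g = 0 → g = 0 := by
  induction a with
  | zero =>
    intro b c hc g hg h
    rw [hg.lap_eq_zero (Or.inl rfl)] at h
    simpa [hc.ne'] using h
  | succ a ih =>
    intro b c hc g hg h
    suffices hl : lap g = 0 by
      rw [hl] at h
      simpa [hc.ne'] using h
    rcases b with _ | b
    · exact hg.lap_eq_zero (Or.inr rfl)
    · have hu := hg.lap'
      refine ih b (a + b + 2 + c) (by omega) (lap g) hu ?_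
      have e : normSqPoly * lap g = 0 - C (c : ℂ) * g := by
        rw [map_natCast]; linear_combination h
      have e2 := congrArg lap e
      rw [lap_normSq hu, lap_sub, lap_C_mul, map_natCast] at e2
      have e0 : lap 0 = 0 := by simp [lap]
      rw [e0] at e2
      push_cast at e2 ⊢
      linear_combination e2

theorem C_inv_mul_cast {c : ℕ} (hc : 0 < c) : (c : P4) * C ((c : ℂ)⁻¹) = 1 := by
  rw [← map_natCast (C : ℂ →+* P4) c, ← C_mul, mul_inv_cancel₀ (by exact_mod_cast hc.ne'), C_1]

theorem exists_aux (a : ℕ) : ∀ (b c : ℕ), 0 < c → ∀ k : P4, IsBihom a b k →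
    ∃ g, IsBihom a b g ∧ normSqPoly * lap g + (c : P4) * g = k := by
  have base : ∀ (a b c : ℕ), 0 < c → (a = 0 ∨ b = 0) → ∀ k : P4, IsBihom a b k →
      ∃ g, IsBihom a b g ∧ normSqPoly * lap g + (c : P4) * g = k := by
    intro a b c hc hab k hk
    refine ⟨C ((c : ℂ)⁻¹) * k, hk.C_mul' _, ?_⟩
    rw [lap_C_mul, hk.lap_eq_zero hab]
    linear_combination k * C_inv_mul_cast hc
  induction a with
  | zero => intro b c hc; exact base 0 b c hc (Or.inl rfl)
  | succ a ih =>
    intro b c hc k hk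
    rcases b with _ | b
    · exact base _ _ c hc (Or.inr rfl) k hk
    · obtain ⟨u, hu, hu'⟩ := ih b (a + b + 2 + c) (by omega) (lap k) hk.lap'
      refine ⟨C ((c : ℂ)⁻¹) * (k - normSqPoly * u), (hk.sub' hu.normSq_mul).C_mul' _, ?_⟩
      have e : lap (C ((c : ℂ)⁻¹) * (k - normSqPoly * u)) = u := by
        rw [lap_C_mul, lap_sub, lap_normSq hu, ← hu']
        push_cast
        linear_combination u * C_inv_mul_cast hc
      rw [e]
      linear_combination (k - normSqPoly * u) * C_inv_mul_cast hc

/-- For `p, q ≥ 1`, `V_{p,q} = H_{p,q} ⊕ ‖z‖²·V_{p−1,q−1}`: every `f ∈ V_{p,q}` is uniquely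
`f = h + ‖z‖²·g` with `h ∈ H_{p,q}` and `g ∈ V_{p−1,q−1}`. -/
theorem stmt_2 (p q : ℕ) (hp : 1 ≤ p) (hq : 1 ≤ q) (f : P4) (hf : IsBihom p q f) :
    ∃! hg : P4 × P4, IsBihom p q hg.1 ∧ lap hg.1 = 0 ∧
      IsBihom (p - 1) (q - 1) hg.2 ∧ f = hg.1 + normSqPoly * hg.2 := by
  obtain ⟨p, rfl⟩ : ∃ p', p = p' + 1 := ⟨p - 1, by omega⟩
  obtain ⟨q, rfl⟩ : ∃ q', q = q' + 1 := ⟨q - 1, by omega⟩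
  simp only [Nat.add_sub_cancel]
  obtain ⟨g, hg, hg'⟩ := exists_aux p q (p + q + 2) (by omega) (lap f) hf.lap'
  refine ⟨(f - normSqPoly * g, g), ⟨hf.sub' hg.normSq_mul, ?_, hg, ?_⟩, ?_⟩
  · change lap (f - normSqPoly * g) = 0
    rw [lap_sub, lap_normSq hg, hg', sub_self]
  · change f = f - normSqPoly * g + normSqPoly * g
    ring
  · rintro ⟨h, g'⟩ ⟨-, hh, hb, hfe⟩
    dsimp only at hh hb hfe
    have hh' : h = f - normSqPoly * g' := by rw [hfe]; ring
    have hl : lap f - lap (normSqPoly * g') = 0 := by rw [← lap_sub, ← hh', hh]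
    rw [lap_normSq hb] at hl
    have : g - g' = 0 := by
      refine uniq_aux p q (p + q + 2) (by omega) _ (hg.sub' hb) ?_
      rw [lap_sub]
      linear_combination hg' + hl
    have hgg : g' = g := (sub_eq_zero.1 this).symm
    rw [hh', hgg]
end
end

section
/- For all p, q ∈ ℕ and every N with 0 ≤ N ≤ p+q, the polynomial E_{p,q,N} is nonzero, bihomogeneous of bidegree (p,q), and harmonic: Δ E_{p,q,N} = 0. -/
open MvPolynomial

noncomputable section

/-- The harmonic polynomial
`E_{p,q,N} = Σ_{α+δ=N, α≤p, δ≤q} (−1)^{q−δ}/(α!(p−α)!(q−δ)!δ!) · z₁^α z₂^{p−α} z̄₁^{q−δ} z̄₂^δ`. -/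
def EPoly (p q N : ℕ) : P4 :=
  ∑ α ∈ Finset.range (p + 1), ∑ δ ∈ Finset.range (q + 1),
    if α + δ = N then
      C ((-1 : ℂ) ^ (q - δ) /
          ((α.factorial * (p - α).factorial * (q - δ).factorial * δ.factorial : ℕ) : ℂ)) *
        (X 0 ^ α * X 1 ^ (p - α) * X 2 ^ (q - δ) * X 3 ^ δ)
    else 0

theorem coeff_EPoly (p q N : ℕ) (d : Fin 4 →₀ ℕ) :
    coeff d (EPoly p q N) = if d 0 + d 1 = p ∧ d 2 + d 3 = q ∧ d 0 + d 3 = N then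
      (-1 : ℂ) ^ (d 2) /
        (((d 0).factorial * (d 1).factorial * (d 2).factorial * (d 3).factorial : ℕ) : ℂ)
      else 0 := by
  have hmon : ∀ (a b c e : ℕ) (r : ℂ),
      coeff d (C r * (X 0 ^ a * X 1 ^ b * X 2 ^ c * X 3 ^ e) : P4)
        = if d 0 = a ∧ d 1 = b ∧ d 2 = c ∧ d 3 = e then r else 0 := by
    intro a b c e r
    have h1 : (X 0 ^ a * X 1 ^ b * X 2 ^ c * X 3 ^ e : P4) =
        monomial (Finsupp.single 0 a + Finsupp.single 1 b + Finsupp.single 2 c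
          + Finsupp.single 3 e) 1 := by
      simp [X_pow_eq_monomial, monomial_mul]
    rw [h1, coeff_C_mul, coeff_monomial]
    have h2 : (Finsupp.single 0 a + Finsupp.single 1 b + Finsupp.single 2 c
          + Finsupp.single 3 e = d) ↔ (d 0 = a ∧ d 1 = b ∧ d 2 = c ∧ d 3 = e) := by
      constructor
      · rintro rfl
        simp [Finsupp.single_apply]
      · rintro ⟨rfl, rfl, rfl, rfl⟩
        ext i
        fin_cases i <;> simp [Finsupp.single_apply]
    simp only [h2]
    split_ifs <;> simp
  unfold EPoly
  simp only [coeff_sum]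
  split_ifs with h
  · obtain ⟨h0, h1, h2⟩ := h
    rw [Finset.sum_eq_single (d 0), Finset.sum_eq_single (d 3)]
    · have e1 : p - d 0 = d 1 := by omega
      have e2 : q - d 3 = d 2 := by omega
      rw [if_pos h2, hmon, e1, e2, if_pos (by simp)]
    · intro b _ hb
      split_ifs
      · rw [hmon, if_neg]; omega
      · simp
    · intro hb; simp only [Finset.mem_range] at hb; omega
    · intro b _ hb
      refine Finset.sum_eq_zero fun c _ => ?_
      split_ifs
      · rw [hmon, if_neg]; omega
      · simp
    · intro hb; simp only [Finset.mem_range] at hb; omega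
  · refine Finset.sum_eq_zero fun b hb => Finset.sum_eq_zero fun c hc => ?_
    simp only [Finset.mem_range] at hb hc
    split_ifs
    · rw [hmon, if_neg]; omega
    · simp

theorem coeff_pd (i : Fin 4) (f : P4) (d : Fin 4 →₀ ℕ) :
    coeff d (pderiv i f) = coeff (d + Finsupp.single i 1) f * ((d i : ℂ) + 1) := by
  induction f using MvPolynomial.induction_on' with
  | monomial u a =>
    rw [pderiv_monomial, coeff_monomial, coeff_monomial]
    by_cases h : u = d + Finsupp.single i 1
    · subst h; simp
    · rw [if_neg h]
      by_cases hu : u i = 0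
      · simp [hu]
      · rw [if_neg, zero_mul]
        rintro rfl
        apply h
        ext j
        by_cases hj : i = j
        · subst hj; simp; omega
        · simp [Finsupp.single_apply, hj]
  | add p q hp hq => simp [hp, hq, add_mul]

/-- For `N ≤ p+q`, the polynomial `E_{p,q,N}` is nonzero, bihomogeneous of bidegree `(p,q)`,
and harmonic. -/
theorem stmt_8 (p q N : ℕ) (hN : N ≤ p + q) :
    EPoly p q N ≠ 0 ∧ IsBihom p q (EPoly p q N) ∧ lap (EPoly p q N) = 0 := by
  refine ⟨?_, ?_, ?_⟩
  · intro h0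
    have h := coeff_EPoly p q N (Finsupp.equivFunOnFinite.symm
      ![min p N, p - min p N, q - (N - min p N), N - min p N])
    rw [h0, coeff_zero] at h
    simp only [Finsupp.equivFunOnFinite_symm_apply_apply, Matrix.cons_val] at h
    rw [if_pos (by omega)] at h
    symm at h
    revert h
    simp [Nat.factorial_ne_zero]
  · intro d hd
    rw [mem_support_iff, coeff_EPoly] at hd
    by_contra hc
    apply hd
    rw [if_neg]
    tauto
  · ext d
    simp only [lap, coeff_add, coeff_pd, coeff_EPoly, coeff_zero]
    simp only [Finsupp.add_apply, Finsupp.single_apply, Fin.reduceEq, if_true, if_false, add_zero]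
    by_cases h : d 0 + 1 + d 1 = p ∧ d 2 + 1 + d 3 = q ∧ d 0 + 1 + d 3 = N
    · rw [if_pos (by omega), if_pos (by omega)]
      have f0 : ∀ n : ℕ, (n.factorial : ℂ) ≠ 0 := fun n => by
        exact_mod_cast n.factorial_ne_zero
      have f1 : ∀ n : ℕ, (n : ℂ) + 1 ≠ 0 := fun n => by exact_mod_cast n.succ_ne_zero
      have := f0 (d 0)
      have := f0 (d 1)
      have := f0 (d 2)
      have := f0 (d 3)
      have := f1 (d 0)
      have := f1 (d 1)
      have := f1 (d 2)
      have := f1 (d 3)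
      simp only [Nat.factorial_succ]
      push_cast
      field_simp
      ring
    · rw [if_neg (by omega), if_neg (by omega)]
      simp
end
end

section
/- The kernel of the induced derivation L̄ on R equals the image in R of the subring ℂ[z₁,z₂]; equivalently, for a polynomial f ∈ ℂ[z₁,z₂,z̄₁,z̄₂], Lf lies in the ideal I if and only if f ∈ ℂ[z₁,z₂] + I. (This is the statement that the zeroth tangential Cauchy–Riemann cohomology H_b^{0,0}(S³) is ℂ[w₁,w₂].) -/
open MvPolynomial

noncomputable section

/-- The derivation `L = z₁·∂/∂z̄₂ − z₂·∂/∂z̄₁`, representing the tangential Cauchy–Riemann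
operator `∂̄_b` of `S³` on `R = 𝒫/I`. -/
def Lop (f : P4) : P4 :=
  X 0 * pderiv (3 : Fin 4) f - X 1 * pderiv (2 : Fin 4) f

/-- The ideal `I = (z₁z̄₁ + z₂z̄₂ − 1)`, so that `R = 𝒫/I` is the polynomial model of
functions on `S³`. -/
def sphereIdeal : Ideal P4 :=
  Ideal.span {X 0 * X 2 + X 1 * X 3 - 1}

/-- `f` involves only the holomorphic variables `z₁, z₂` (it lies in the subring
`ℂ[z₁,z₂] ⊆ 𝒫`). -/
def OnlyHolo (f : P4) : Prop :=
  ∀ d ∈ f.support, d 2 = 0 ∧ d 3 = 0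

theorem aux_coeff (k : Fin 4) (f : P4) (h : pderiv k f = 0) (d : Fin 4 →₀ ℕ)
    (hd : d ∈ f.support) : d k = 0 := by
  by_contra hk
  have h1 := coeff_pderiv (i := k) f (d - Finsupp.single k 1)
  rw [h, coeff_zero, Finsupp.sub_add_single_one_cancel hk] at h1
  rcases mul_eq_zero.1 h1.symm with h2 | h2
  · exact (mem_support_iff.1 hd) h2
  · exact Nat.cast_add_one_ne_zero _ h2

theorem aux_notMem_vars (k : Fin 4) (f : P4) (h : pderiv k f = 0) : k ∉ f.vars := by
  intro hk
  obtain ⟨d, hd, hkd⟩ := (mem_vars k).1 hk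
  exact (Finsupp.mem_support_iff.1 hkd) (aux_coeff k f h d hd)

theorem onlyHolo_iff (f : P4) : OnlyHolo f ↔ pderiv 2 f = 0 ∧ pderiv 3 f = 0 := by
  constructor
  · intro h
    constructor
    · apply pderiv_eq_zero_of_notMem_vars
      intro hk
      obtain ⟨d, hd, hkd⟩ := (mem_vars _).1 hk
      exact (Finsupp.mem_support_iff.1 hkd) (h d hd).1
    · apply pderiv_eq_zero_of_notMem_vars
      intro hk
      obtain ⟨d, hd, hkd⟩ := (mem_vars _).1 hk
      exact (Finsupp.mem_support_iff.1 hkd) (h d hd).2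
  · rintro ⟨h2, h3⟩ d hd
    exact ⟨aux_coeff 2 f h2 d hd, aux_coeff 3 f h3 d hd⟩

theorem aux_comm (k l : Fin 4) (f : P4) : pderiv k (pderiv l f) = pderiv l (pderiv k f) := by
  rcases eq_or_ne k l with rfl | hkl
  · rfl
  ext d
  simp only [coeff_pderiv, Finsupp.add_apply, Finsupp.single_eq_of_ne hkl,
    Finsupp.single_eq_of_ne hkl.symm]
  rw [add_right_comm d]
  push_cast
  ring

/-- The sphere ideal contains no nonzero polynomial free of the variable `k`. -/
theorem aux_inter (i j k l : Fin 4) (hik : i ≠ k) (hjk : j ≠ k) (hlk : l ≠ k) (F : P4)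
    (hF : F ∈ Ideal.span {(X i * X k + X j * X l - 1 : P4)}) (h : pderiv k F = 0) : F = 0 := by
  let K := FractionRing P4
  let ι : P4 →+* K := algebraMap P4 K
  have hι : Function.Injective ι := IsFractionRing.injective P4 K
  have hi0 : ι (X i) ≠ 0 := by
    rw [Ne, map_eq_zero_iff ι hι]; exact X_ne_zero i
  let φ : P4 →+* K := eval₂Hom (ι.comp C)
    (fun m => if m = k then (1 - ι (X j) * ι (X l)) / ι (X i) else ι (X m))
  have hX : ∀ m, m ≠ k → φ (X m) = ι (X m) := by
    intro m hm; simp [φ, hm]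
  have hk : φ (X k) = (1 - ι (X j) * ι (X l)) / ι (X i) := by simp [φ]
  have h1 : φ F = ι F := by
    apply hom_congr_vars
    · ext <;> simp [φ]
    · intro m hm _
      apply hX
      rintro rfl
      exact aux_notMem_vars _ F h hm
    · rfl
  obtain ⟨c, rfl⟩ := Ideal.mem_span_singleton.1 hF
  apply hι
  rw [← h1, map_zero, map_mul]
  have : φ (X i * X k + X j * X l - 1) = 0 := by
    rw [map_sub, map_add, map_mul, map_mul, hk, hX i hik, hX j hjk, hX l hlk, map_one]
    rw [mul_div_cancel₀ _ hi0]
    ring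
  rw [this, zero_mul]

/-- After multiplication by a power of `X i`, the variable `k` can be eliminated. -/
theorem aux_elim (i j k l : Fin 4) (hik : i ≠ k) (hjk : j ≠ k) (hlk : l ≠ k) (f : P4) :
    ∃ (n : ℕ) (F : P4), pderiv k F = 0 ∧
      X i ^ n * f - F ∈ Ideal.span {(X i * X k + X j * X l - 1 : P4)} := by
  have hi : pderiv k (X i : P4) = 0 := pderiv_X_of_ne hik
  have hj : pderiv k (X j : P4) = 0 := pderiv_X_of_ne hjk
  have hl : pderiv k (X l : P4) = 0 := pderiv_X_of_ne hlk
  induction f using MvPolynomial.induction_on with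
  | C a => exact ⟨0, C a, pderiv_C, by simp⟩
  | add p q hp hq =>
    obtain ⟨n, F, hF, hn⟩ := hp
    obtain ⟨m, G, hG, hm⟩ := hq
    refine ⟨n + m, X i ^ m * F + X i ^ n * G, ?_, ?_⟩
    · simp [pderiv_mul, pderiv_pow, hF, hG, hi]
    · have := Ideal.add_mem _ (Ideal.mul_mem_left _ (X i ^ m) hn)
        (Ideal.mul_mem_left _ (X i ^ n) hm)
      convert this using 1
      ring
  | mul_X p m hp =>
    obtain ⟨n, F, hF, hn⟩ := hp
    rcases eq_or_ne m k with rfl | hm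
    · refine ⟨n + 1, F * (1 - X j * X l), ?_, ?_⟩
      · simp [pderiv_mul, hF, hj, hl]
      · have := Ideal.add_mem _ (Ideal.mul_mem_left _ (X i * X m) hn)
          (Ideal.mul_mem_left _ F (Ideal.mem_span_singleton_self
            (X i * X m + X j * X l - 1 : P4)))
        convert this using 1
        ring
    · refine ⟨n, F * X m, ?_, ?_⟩
      · simp [pderiv_mul, hF, pderiv_X_of_ne hm]
      · have := Ideal.mul_mem_left _ (X m) hn
        convert this using 1
        ring

/-- The operator preserves the ideal. -/
theorem aux_stable (i j k l : Fin 4) (hik : i ≠ k) (hjk : j ≠ k) (hlk : l ≠ k)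
    (hil : i ≠ l) (hjl : j ≠ l) (u : P4)
    (hu : u ∈ Ideal.span {(X i * X k + X j * X l - 1 : P4)}) :
    X i * pderiv l u - X j * pderiv k u ∈
      Ideal.span {(X i * X k + X j * X l - 1 : P4)} := by
  obtain ⟨c, rfl⟩ := Ideal.mem_span_singleton.1 hu
  refine Ideal.mem_span_singleton.2 ⟨X i * pderiv l c - X j * pderiv k c, ?_⟩
  simp only [pderiv_mul, map_sub, map_add, pderiv_one, pderiv_X_self, pderiv_X_of_ne hik,
    pderiv_X_of_ne hjk, pderiv_X_of_ne hlk, pderiv_X_of_ne hil, pderiv_X_of_ne hjl,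
    pderiv_X_of_ne hlk.symm]
  ring

theorem aux_local (i j k l : Fin 4) (hik : i ≠ k) (hjk : j ≠ k) (hlk : l ≠ k)
    (hil : i ≠ l) (hjl : j ≠ l) (f : P4)
    (hf : X i * pderiv l f - X j * pderiv k f ∈
      Ideal.span {(X i * X k + X j * X l - 1 : P4)}) :
    ∃ (n : ℕ) (F : P4), pderiv k F = 0 ∧ pderiv l F = 0 ∧
      X i ^ n * f - F ∈ Ideal.span {(X i * X k + X j * X l - 1 : P4)} := by
  obtain ⟨n, F, hF, hn⟩ := aux_elim i j k l hik hjk hlk f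
  refine ⟨n, F, hF, ?_, hn⟩
  have h1 := aux_stable i j k l hik hjk hlk hil hjl _ hn
  have h2 := Ideal.sub_mem _ (Ideal.mul_mem_left _ (X i ^ n) hf) h1
  have h3 : X i * pderiv l F = 0 := by
    apply aux_inter i j k l hik hjk hlk
    · convert h2 using 1
      simp only [pderiv_mul, map_sub, pderiv_pow, pderiv_X_of_ne hik, pderiv_X_of_ne hil, hF]
      ring
    · rw [pderiv_mul, aux_comm, hF, pderiv_X_of_ne hik]
      simp
  exact (mul_eq_zero.1 h3).resolve_left (X_ne_zero i)

/-- The kernel of the induced derivation `L̄` on `R = 𝒫/I` is the image of `ℂ[z₁,z₂]`: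
for `f ∈ 𝒫`, `Lf ∈ I` iff `f ∈ ℂ[z₁,z₂] + I`.  (I.e. `H_b^{0,0}(S³) = ℂ[w₁,w₂]`.) -/
theorem stmt_12 (f : P4) :
    Lop f ∈ sphereIdeal ↔ ∃ g : P4, OnlyHolo g ∧ f - g ∈ sphereIdeal := by
  constructor
  · intro hf
    have hI : Ideal.span {(X 1 * X 3 + X 0 * X 2 - 1 : P4)} = sphereIdeal := by
      rw [sphereIdeal, add_comm]
    obtain ⟨n, G, hG2, hG3, hn⟩ := aux_local 0 1 2 3 (by decide) (by decide) (by decide)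
      (by decide) (by decide) f hf
    obtain ⟨m, H, hH3, hH2, hm⟩ := aux_local 1 0 3 2 (by decide) (by decide) (by decide)
      (by decide) (by decide) f (by
        rw [hI]
        have := neg_mem hf
        convert this using 1
        rw [Lop]; ring)
    rw [hI] at hm
    change _ ∈ sphereIdeal at hn
    have e02 : pderiv 2 (X 0 : P4) = 0 := pderiv_X_of_ne (by decide)
    have e12 : pderiv 2 (X 1 : P4) = 0 := pderiv_X_of_ne (by decide)
    have e03 : pderiv 3 (X 0 : P4) = 0 := pderiv_X_of_ne (by decide)
    have key : X 0 ^ n * H - X 1 ^ m * G = 0 := by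
      apply aux_inter 0 1 2 3 (by decide) (by decide) (by decide)
      · have := Ideal.sub_mem _ (Ideal.mul_mem_left _ (X 1 ^ m) hn)
          (Ideal.mul_mem_left _ (X 0 ^ n) hm)
        change _ ∈ sphereIdeal
        convert this using 1
        ring
      · simp [pderiv_mul, pderiv_pow, hG2, hH2, e02, e12]
    have h0n : (X 0 ^ n : P4) ≠ 0 := pow_ne_zero _ (X_ne_zero 0)
    have hdvd : (X 0 ^ n : P4) ∣ G := by
      have hp : Prime (X 0 : P4) := X_prime
      have hnd : ¬ (X 0 : P4) ∣ X 1 ^ m := by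
        intro h
        have := X_dvd_X.1 (hp.dvd_of_dvd_pow h)
        revert this
        decide
      exact hp.pow_dvd_of_dvd_mul_left n hnd ⟨H, (sub_eq_zero.1 key).symm⟩
    obtain ⟨g, rfl⟩ := hdvd
    have hH : H = X 1 ^ m * g := by
      apply mul_left_cancel₀ h0n
      linear_combination key
    subst hH
    refine ⟨g, (onlyHolo_iff g).2 ⟨?_, ?_⟩, ?_⟩
    · simpa [pderiv_mul, pderiv_pow, e02] using hG2
    · simpa [pderiv_mul, pderiv_pow, e03] using hG3
    · rw [← mul_sub] at hn hm
      rw [← Ideal.Quotient.eq_zero_iff_mem] at hn hm ⊢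
      rw [map_mul, map_pow] at hn hm
      set π := Ideal.Quotient.mk sphereIdeal
      have hc : IsCoprime (π (X 0)) (π (X 1)) := by
        refine ⟨π (X 2), π (X 3), ?_⟩
        rw [← map_mul, ← map_mul, ← map_add, ← map_one π, Ideal.Quotient.mk_eq_mk_iff_sub_mem]
        have : (X 0 * X 2 + X 1 * X 3 - 1 : P4) ∈ sphereIdeal :=
          Ideal.mem_span_singleton_self _
        convert this using 1
        ring
      obtain ⟨a, b, hab⟩ := hc.pow (m := n) (n := m)
      linear_combination a * hn + b * hm - π (f - g) * hab
  · rintro ⟨g, hg, hfg⟩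
    obtain ⟨h2, h3⟩ := (onlyHolo_iff g).1 hg
    have := aux_stable 0 1 2 3 (by decide) (by decide) (by decide) (by decide) (by decide) _ hfg
    rw [map_sub, map_sub, h2, h3, sub_zero, sub_zero] at this
    exact this
end
end

section
/- R is the internal direct sum, as a ℂ-vector space, of the image L̄(R) of the induced derivation and the image of the subring ℂ[z̄₁,z̄₂] in R: these two subspaces intersect only in 0 and together span R. (This is the statement that the first tangential Cauchy–Riemann cohomology H_b^{0,1}(S³) is ℂ[w̄₁,w̄₂]·ε.) -/
open MvPolynomial

noncomputable section

/-- `f` involves only the antiholomorphic variables `z̄₁, z̄₂` (it lies in the subring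
`ℂ[z̄₁,z̄₂] ⊆ 𝒫`). -/
def OnlyAnti (f : P4) : Prop :=
  ∀ d ∈ f.support, d 0 = 0 ∧ d 1 = 0

theorem Lop_add (f g : P4) : Lop (f + g) = Lop f + Lop g := by
  simp only [Lop, map_add]; ring

theorem Lop_C_mul (a : ℂ) (f : P4) : Lop (C a * f) = C a * Lop f := by
  simp only [Lop, pderiv_C_mul, smul_eq_C_mul]; ring

def Good (f : P4) : Prop := ∃ g h : P4, OnlyAnti h ∧ f - (Lop g + h) ∈ sphereIdeal

theorem OnlyAnti.add {f g : P4} (hf : OnlyAnti f) (hg : OnlyAnti g) : OnlyAnti (f + g) := by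
  classical
  intro d hd
  rcases Finset.mem_union.1 (support_add hd) with h | h
  exacts [hf d h, hg d h]

theorem OnlyAnti.C_mul {f : P4} (a : ℂ) (hf : OnlyAnti f) : OnlyAnti (C a * f) := by
  intro d hd
  apply hf d
  rw [mem_support_iff] at hd ⊢
  rw [coeff_C_mul] at hd
  exact right_ne_zero_of_mul hd

theorem Good.add {f g : P4} (hf : Good f) (hg : Good g) : Good (f + g) := by
  obtain ⟨a, b, h1, h2⟩ := hf
  obtain ⟨a', b', h1', h2'⟩ := hg
  refine ⟨a + a', b + b', h1.add h1', ?_⟩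
  have := sphereIdeal.add_mem h2 h2'
  rw [Lop_add]
  convert this using 1
  ring

theorem Good.C_mul {f : P4} (c : ℂ) (hf : Good f) : Good (C c * f) := by
  obtain ⟨a, b, h1, h2⟩ := hf
  refine ⟨C c * a, C c * b, h1.C_mul c, ?_⟩
  have := sphereIdeal.mul_mem_left (C c) h2
  rw [Lop_C_mul]
  convert this using 1
  ring

theorem Good.of_sub {f g k : P4} (hg : Good g) (h : f - (g + Lop k) ∈ sphereIdeal) : Good f := by
  obtain ⟨a, b, h1, h2⟩ := hg
  refine ⟨a + k, b, h1, ?_⟩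
  have := sphereIdeal.add_mem h h2
  rw [Lop_add]
  convert this using 1
  ring

theorem rho_mem (u : P4) : (X 0 * X 2 + X 1 * X 3 - 1) * u ∈ sphereIdeal :=
  Ideal.mul_mem_right _ _ (Ideal.subset_span rfl)

theorem Lop_X3 (e : Fin 4 →₀ ℕ) (a : ℂ) :
    Lop (X 3 * monomial e a) = C ((e 2 + e 3 + 1 : ℕ) : ℂ) * (X 0 * monomial e a)
      - (X 0 * X 2 + X 1 * X 3) * pderiv 2 (monomial e a) := by
  have h2 := X_mul_pderiv_monomial (R := ℂ) (i := (2 : Fin 4)) (m := e) (r := a)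
  have h3 := X_mul_pderiv_monomial (R := ℂ) (i := (3 : Fin 4)) (m := e) (r := a)
  rw [nsmul_eq_mul] at h2 h3
  have e1 : pderiv (3 : Fin 4) (X 3 : P4) = 1 := pderiv_X_self 3
  have e2 : pderiv (2 : Fin 4) (X 3 : P4) = 0 := pderiv_X_of_ne (by decide)
  simp only [Lop, pderiv_mul, e1, e2, map_natCast]
  push_cast
  linear_combination X 0 * h2 + X 0 * h3

theorem Lop_X2 (e : Fin 4 →₀ ℕ) (a : ℂ) :
    Lop (X 2 * monomial e a) = -(C ((e 2 + e 3 + 1 : ℕ) : ℂ) * (X 1 * monomial e a)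
      - (X 0 * X 2 + X 1 * X 3) * pderiv 3 (monomial e a)) := by
  have h2 := X_mul_pderiv_monomial (R := ℂ) (i := (2 : Fin 4)) (m := e) (r := a)
  have h3 := X_mul_pderiv_monomial (R := ℂ) (i := (3 : Fin 4)) (m := e) (r := a)
  rw [nsmul_eq_mul] at h2 h3
  have e1 : pderiv (3 : Fin 4) (X 2 : P4) = 0 := pderiv_X_of_ne (by decide)
  have e2 : pderiv (2 : Fin 4) (X 2 : P4) = 1 := pderiv_X_self 2
  simp only [Lop, pderiv_mul, e1, e2, map_natCast]
  push_cast
  linear_combination - X 1 * h2 - X 1 * h3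

theorem C_inv_mul_self (n : ℕ) (p : P4) :
    C (((n + 1 : ℕ) : ℂ)⁻¹) * (C ((n + 1 : ℕ) : ℂ) * p) = p := by
  rw [← mul_assoc, ← C_mul, inv_mul_cancel₀ (Nat.cast_ne_zero.2 (Nat.succ_ne_zero n)), C_1, one_mul]

theorem good_X0 (e : Fin 4 →₀ ℕ) (a : ℂ) (h : Good (pderiv 2 (monomial e a))) :
    Good (X 0 * monomial e a) := by
  rw [← C_inv_mul_self (e 2 + e 3) (X 0 * monomial e a)]
  apply Good.C_mul
  refine h.of_sub (k := X 3 * monomial e a) ?_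
  rw [Lop_X3]
  convert rho_mem (pderiv 2 (monomial e a)) using 1
  ring

theorem good_X1 (e : Fin 4 →₀ ℕ) (a : ℂ) (h : Good (pderiv 3 (monomial e a))) :
    Good (X 1 * monomial e a) := by
  rw [← C_inv_mul_self (e 2 + e 3) (X 1 * monomial e a)]
  apply Good.C_mul
  refine h.of_sub (k := C (-1) * (X 2 * monomial e a)) ?_
  rw [Lop_C_mul, Lop_X2]
  convert rho_mem (pderiv 3 (monomial e a)) using 1
  simp only [map_neg, C_1]
  ring

theorem good_monomial (n : ℕ) : ∀ (d : Fin 4 →₀ ℕ) (a : ℂ), d 0 + d 1 = n →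
    Good (monomial d a) := by
  induction n with
  | zero =>
    intro d a hd
    refine ⟨0, monomial d a, ?_, ?_⟩
    · intro d' hd'
      have := Finset.mem_singleton.1 (support_monomial_subset hd')
      subst this
      omega
    · simp [Lop]
  | succ n ih =>
    intro d a hd
    by_cases h0 : d 0 = 0
    · have hle : Finsupp.single 1 1 ≤ d := by
        rw [Finsupp.single_le_iff]; omega
      have : monomial d a = X 1 * monomial (d - Finsupp.single 1 1) a := by
        rw [X, monomial_mul, one_mul, add_tsub_cancel_of_le hle]
      rw [this]
      apply good_X1
      rw [pderiv_monomial]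
      apply ih
      simp [Finsupp.single_apply]
      omega
    · have hle : Finsupp.single 0 1 ≤ d := by
        rw [Finsupp.single_le_iff]; omega
      have : monomial d a = X 0 * monomial (d - Finsupp.single 0 1) a := by
        rw [X, monomial_mul, one_mul, add_tsub_cancel_of_le hle]
      rw [this]
      apply good_X0
      rw [pderiv_monomial]
      apply ih
      simp [Finsupp.single_apply]
      omega

theorem good_all (f : P4) : Good f := by
  induction f using MvPolynomial.induction_on' with
  | monomial d a => exact good_monomial _ d a rfl
  | add p q hp hq => exact hp.add hq

/-- weights of the separating functionals -/
def wt (p q : ℕ) (d : Fin 4 →₀ ℕ) : ℂ :=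
  if d 2 = d 0 + p ∧ d 3 = d 1 + q then
    ((d 2).factorial * (d 3).factorial : ℂ) / ((d 2 + d 3 + 1).factorial : ℂ) else 0

def phi (p q : ℕ) : P4 →ₗ[ℂ] ℂ := (basisMonomials (Fin 4) ℂ).constr ℂ (wt p q)

theorem phi_monomial (p q : ℕ) (d : Fin 4 →₀ ℕ) (a : ℂ) :
    phi p q (monomial d a) = a * wt p q d := by
  have h : (monomial d a : P4) = a • basisMonomials (Fin 4) ℂ d := by
    simp [smul_monomial]
  rw [h, map_smul, phi, Module.Basis.constr_basis, smul_eq_mul]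

theorem phi_Lop (p q : ℕ) (f : P4) : phi p q (Lop f) = 0 := by
  induction f using MvPolynomial.induction_on' with
  | add f g hf hg => rw [Lop_add, map_add, hf, hg, add_zero]
  | monomial d a =>
    simp only [Lop, pderiv_monomial, X, monomial_mul, map_sub, phi_monomial, wt]
    simp only [Finsupp.add_apply, Finsupp.tsub_apply, Finsupp.single_apply, Fin.reduceEq, if_true,
      if_false, zero_add, tsub_zero, one_mul]
    rcases h2 : d 2 with _ | m
    · rcases h3 : d 3 with _ | k
      · simp
      · rw [if_neg (by omega)]; simp
    · rcases h3 : d 3 with _ | k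
      · rw [if_neg (c := m + 1 - 1 = d 0 + p ∧ 0 = 1 + d 1 + q) (by omega)]; simp
      · by_cases hc : m = d 0 + p ∧ k = d 1 + q
        · rw [if_pos (by omega), if_pos (by omega)]
          have e1 : m + 1 + (k + 1 - 1) + 1 = m + k + 2 := by omega
          have e2 : m + 1 - 1 + (k + 1) + 1 = m + k + 2 := by omega
          rw [e1, e2]
          simp only [Nat.add_sub_cancel, Nat.factorial_succ]
          push_cast
          ring
        · rw [if_neg (by omega), if_neg (by omega)]; simp

theorem phi_rho (p q : ℕ) (f : P4) :
    phi p q ((X 0 * X 2 + X 1 * X 3 - 1) * f) = 0 := by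
  induction f using MvPolynomial.induction_on' with
  | add f g hf hg => rw [mul_add, map_add, hf, hg, add_zero]
  | monomial d a =>
    simp only [add_mul, sub_mul, X, monomial_mul, map_sub, map_add, phi_monomial, wt, one_mul]
    simp only [Finsupp.add_apply, Finsupp.single_apply, Fin.reduceEq, if_true,
      if_false, zero_add, add_zero]
    by_cases hc : d 2 = d 0 + p ∧ d 3 = d 1 + q
    · rw [if_pos (by omega), if_pos (by omega), if_pos hc]
      have e1 : 1 + d 2 + d 3 + 1 = (d 2 + d 3 + 1) + 1 := by omega
      have e2 : d 2 + (1 + d 3) + 1 = (d 2 + d 3 + 1) + 1 := by omega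
      rw [e1, e2, add_comm 1 (d 2), add_comm 1 (d 3), Nat.factorial_succ (d 2),
        Nat.factorial_succ (d 3), Nat.factorial_succ (d 2 + d 3 + 1)]
      have n1 : ((d 2 + d 3 + 1).factorial : ℂ) ≠ 0 := Nat.cast_ne_zero.2 (Nat.factorial_ne_zero _)
      have n2 : ((d 2 + d 3 + 1 + 1 : ℕ) : ℂ) ≠ 0 := Nat.cast_ne_zero.2 (Nat.succ_ne_zero _)
      push_cast at n2 ⊢
      field_simp
      ring
    · rw [if_neg (by omega), if_neg (by omega), if_neg hc]; simp

theorem phi_ideal (p q : ℕ) (f : P4) (hf : f ∈ sphereIdeal) : phi p q f = 0 := by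
  obtain ⟨c, rfl⟩ := Ideal.mem_span_singleton.1 hf
  exact phi_rho p q c

theorem anti_eq_zero (h : P4) (ha : OnlyAnti h) (h0 : ∀ p q, phi p q h = 0) : h = 0 := by
  ext d
  rw [coeff_zero]
  by_contra hd
  obtain ⟨d0, d1⟩ := ha d (mem_support_iff.2 hd)
  have key := h0 (d 2) (d 3)
  rw [h.as_sum, map_sum, Finset.sum_eq_single d] at key
  · rw [phi_monomial, wt, if_pos (by omega)] at key
    have n1 (n : ℕ) : (n.factorial : ℂ) ≠ 0 := Nat.cast_ne_zero.2 (Nat.factorial_ne_zero _)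
    exact mul_ne_zero hd (div_ne_zero (mul_ne_zero (n1 _) (n1 _)) (n1 _)) key
  · intro e he hne
    obtain ⟨e0, e1⟩ := ha e he
    rw [phi_monomial, wt, if_neg, mul_zero]
    rintro ⟨h2, h3⟩
    apply hne
    ext i
    fin_cases i <;> simp <;> omega
  · intro hn
    exact absurd (mem_support_iff.2 hd) hn

/-- `R = 𝒫/I` is the internal direct sum of the image `L̄(R)` of the induced derivation and
the image of `ℂ[z̄₁,z̄₂]`: together they span `R`, and they intersect only in `0`.
(I.e. `H_b^{0,1}(S³) = ℂ[w̄₁,w̄₂]·ε`.) -/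
theorem stmt_13 :
    (∀ f : P4, ∃ g h : P4, OnlyAnti h ∧ f - (Lop g + h) ∈ sphereIdeal) ∧
    (∀ g h : P4, OnlyAnti h → Lop g - h ∈ sphereIdeal →
      h ∈ sphereIdeal ∧ Lop g ∈ sphereIdeal) := by
  refine ⟨good_all, fun g h ha hm => ?_⟩
  have h0 : h = 0 := by
    apply anti_eq_zero h ha
    intro p q
    have := phi_ideal p q _ hm
    rw [map_sub, phi_Lop, zero_sub, neg_eq_zero] at this
    exact this
  subst h0
  exact ⟨Ideal.zero_mem _, by simpa using hm⟩
end
end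

section
/- Let p, q, r, s ∈ ℕ, let f be the function (z₁,z₂) ↦ z₁^p z₂^q conj(z₁)^r conj(z₂)^s on S³, and let Π denote the orthogonal projection in L²(S³,σ) onto the closed linear span of the antiholomorphic monomials {conj(z₁)^a conj(z₂)^b : a,b ∈ ℕ}. If p ≤ r and q ≤ s, then Π f = (r!·s!·(r+s−p−q+1)!)/((r+s+1)!·(r−p)!·(s−q)!) · conj(z₁)^{r−p} conj(z₂)^{s−q}; if p > r or q > s, then Π f = 0. (This computes the product m₂ on the tangential Cauchy–Riemann cohomology of S³.) -/
open MvPolynomial MeasureTheory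

noncomputable section

/-- Evaluation of a polynomial in `ℂ[z₁,z₂,z̄₁,z̄₂]` as a function on `ℂ²`,
substituting `z̄ᵢ := conj zᵢ`. -/
def evalSphere (f : P4) (v : ℂ × ℂ) : ℂ :=
  MvPolynomial.eval ![v.1, v.2, (starRingEnd ℂ) v.1, (starRingEnd ℂ) v.2] f

/-- `μ` (a measure on `ℂ²`) is the standard rotation-invariant surface measure of the unit
sphere `S³ = {(z₁,z₂) : |z₁|² + |z₂|² = 1}` with total mass `2π²`: it is concentrated on `S³`,
has total mass `2π²`, and is invariant under the unitary rotations of `ℂ²`. -/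
def IsSphereMeasure (μ : Measure (ℂ × ℂ)) : Prop :=
  μ Set.univ = ENNReal.ofReal (2 * Real.pi ^ 2) ∧
  μ {v : ℂ × ℂ | Complex.normSq v.1 + Complex.normSq v.2 ≠ 1} = 0 ∧
  ∀ U : Matrix (Fin 2) (Fin 2) ℂ, U ∈ Matrix.unitaryGroup (Fin 2) ℂ →
    μ.map (fun v : ℂ × ℂ => (U 0 0 * v.1 + U 0 1 * v.2, U 1 0 * v.1 + U 1 1 * v.2)) = μ

/-- The mixed moment of `z₁^a z₂^b z̄₁^c z̄₂^d`. -/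
def mom (μ : Measure (ℂ × ℂ)) (a b c d : ℕ) : ℂ :=
  ∫ v : ℂ × ℂ, v.1 ^ a * v.2 ^ b * (starRingEnd ℂ) v.1 ^ c * (starRingEnd ℂ) v.2 ^ d ∂μ

theorem mom_cont (a b c d : ℕ) : Continuous (fun v : ℂ × ℂ =>
    v.1 ^ a * v.2 ^ b * (starRingEnd ℂ) v.1 ^ c * (starRingEnd ℂ) v.2 ^ d) := by
  have h := Complex.continuous_conj
  fun_prop

theorem sph_ae {μ : Measure (ℂ × ℂ)} (hμ : IsSphereMeasure μ) :
    ∀ᵐ v ∂μ, Complex.normSq v.1 + Complex.normSq v.2 = 1 := by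
  rw [ae_iff]; exact hμ.2.1

theorem sph_fin {μ : Measure (ℂ × ℂ)} (hμ : IsSphereMeasure μ) : IsFiniteMeasure μ :=
  ⟨by rw [hμ.1]; exact ENNReal.ofReal_lt_top⟩

theorem mom_int {μ : Measure (ℂ × ℂ)} (hμ : IsSphereMeasure μ) (a b c d : ℕ) :
    Integrable (fun v : ℂ × ℂ =>
      v.1 ^ a * v.2 ^ b * (starRingEnd ℂ) v.1 ^ c * (starRingEnd ℂ) v.2 ^ d) μ := by
  haveI := sph_fin hμ
  refine Integrable.of_bound (mom_cont a b c d).aestronglyMeasurable 1 ?_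
  filter_upwards [sph_ae hμ] with v hv
  rw [Complex.normSq_eq_norm_sq, Complex.normSq_eq_norm_sq] at hv
  have h1 : ‖v.1‖ ≤ 1 := by nlinarith [norm_nonneg v.1, sq_nonneg ‖v.2‖]
  have h2 : ‖v.2‖ ≤ 1 := by nlinarith [norm_nonneg v.2, sq_nonneg ‖v.1‖]
  simp only [norm_mul, norm_pow, RCLike.norm_conj]
  have e1 := pow_le_one₀ (n := a) (norm_nonneg _) h1
  have e2 := pow_le_one₀ (n := b) (norm_nonneg _) h2
  have e3 := pow_le_one₀ (n := c) (norm_nonneg _) h1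
  have e4 := pow_le_one₀ (n := d) (norm_nonneg _) h2
  refine mul_le_one₀ (mul_le_one₀ (mul_le_one₀ e1 (by positivity) e2) (by positivity) e3)
    (by positivity) e4

theorem sph_inv {μ : Measure (ℂ × ℂ)} (hμ : IsSphereMeasure μ)
    (U : Matrix (Fin 2) (Fin 2) ℂ) (hU : U ∈ Matrix.unitaryGroup (Fin 2) ℂ)
    (f : ℂ × ℂ → ℂ) (hf : Continuous f) :
    ∫ v, f (U 0 0 * v.1 + U 0 1 * v.2, U 1 0 * v.1 + U 1 1 * v.2) ∂μ = ∫ v, f v ∂μ := by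
  conv_rhs => rw [← hμ.2.2 U hU]
  rw [integral_map]
  · exact Continuous.aemeasurable (by fun_prop)
  · exact hf.aestronglyMeasurable

theorem exists_unit (a c : ℕ) (h : a ≠ c) :
    ∃ u : ℂ, u * (starRingEnd ℂ) u = 1 ∧ u ^ a * (starRingEnd ℂ) u ^ c = -1 := by
  have hne : ((a : ℂ) - c) ≠ 0 := by
    rw [sub_ne_zero]; exact_mod_cast h
  refine ⟨Complex.exp ((Real.pi / ((a : ℝ) - c) : ℝ) * Complex.I), ?_, ?_⟩
  · rw [← Complex.exp_conj, ← Complex.exp_add]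
    simp
  · rw [← Complex.exp_conj, ← Complex.exp_nat_mul, ← Complex.exp_nat_mul, ← Complex.exp_add,
      ← Complex.exp_pi_mul_I]
    congr 1
    simp only [map_mul, Complex.conj_ofReal, Complex.conj_I]
    push_cast
    field_simp
    ring

theorem mom_zero1 {μ : Measure (ℂ × ℂ)} (hμ : IsSphereMeasure μ) (a b c d : ℕ) (h : a ≠ c) :
    mom μ a b c d = 0 := by
  obtain ⟨u, hu, hu2⟩ := exists_unit a c h
  have := sph_inv hμ !![u, 0; 0, 1] (by
    rw [Matrix.mem_unitaryGroup_iff]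
    ext i j
    fin_cases i <;> fin_cases j <;> simp [Matrix.mul_apply, Fin.sum_univ_two, hu]) _
    (mom_cont a b c d)
  have h2 : -mom μ a b c d = mom μ a b c d := by
    unfold mom
    rw [← integral_neg, ← this]
    congr 1
    ext v
    simp [mul_pow]
    linear_combination -(v.1 ^ a * v.2 ^ b * (starRingEnd ℂ) v.1 ^ c * (starRingEnd ℂ) v.2 ^ d) * hu2
  exact self_eq_neg.mp h2.symm

theorem mom_zero2 {μ : Measure (ℂ × ℂ)} (hμ : IsSphereMeasure μ) (a b c d : ℕ) (h : b ≠ d) :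
    mom μ a b c d = 0 := by
  obtain ⟨u, hu, hu2⟩ := exists_unit b d h
  have := sph_inv hμ !![1, 0; 0, u] (by
    rw [Matrix.mem_unitaryGroup_iff]
    ext i j
    fin_cases i <;> fin_cases j <;> simp [Matrix.mul_apply, Fin.sum_univ_two, hu]) _
    (mom_cont a b c d)
  have h2 : -mom μ a b c d = mom μ a b c d := by
    unfold mom
    rw [← integral_neg, ← this]
    congr 1
    ext v
    simp [mul_pow]
    linear_combination -(v.1 ^ a * v.2 ^ b * (starRingEnd ℂ) v.1 ^ c * (starRingEnd ℂ) v.2 ^ d) * hu2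
  exact self_eq_neg.mp h2.symm

theorem mom_rot {μ : Measure (ℂ × ℂ)} (hμ : IsSphereMeasure μ) (N : ℕ) (t : ℝ) :
    ∫ v : ℂ × ℂ, (v.1 + t * v.2) ^ N * ((starRingEnd ℂ) v.1 + t * (starRingEnd ℂ) v.2) ^ N ∂μ
      = (1 + (t : ℂ) ^ 2) ^ N * mom μ N 0 N 0 := by
  have hpos : 0 < 1 + t ^ 2 := by positivity
  obtain ⟨w, hw⟩ : ∃ w : ℝ, w * w * (1 + t ^ 2) = 1 :=
    ⟨(Real.sqrt (1 + t ^ 2))⁻¹, by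
      rw [← mul_inv, Real.mul_self_sqrt hpos.le, inv_mul_cancel₀ hpos.ne']⟩
  have hwc : (w : ℂ) * w * (1 + (t : ℂ) ^ 2) = 1 := by exact_mod_cast hw
  have := sph_inv hμ !![(w : ℂ), w * t; -(w * t), w] (by
    rw [Matrix.mem_unitaryGroup_iff]
    ext i j
    fin_cases i <;> fin_cases j <;> simp [Matrix.mul_apply, Fin.sum_univ_two] <;>
      first | ring1 | linear_combination hwc) _
    (mom_cont N 0 N 0)
  unfold mom
  rw [← this, ← integral_const_mul]
  congr 1
  ext v
  simp only [Matrix.of_apply, Matrix.cons_val', Matrix.cons_val_zero, Matrix.cons_val_one,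
    Matrix.cons_val_fin_one, pow_zero, mul_one, map_add, map_mul, Complex.conj_ofReal]
  rw [← mul_pow, ← mul_pow, ← mul_pow]
  congr 1
  linear_combination
    (-(v.1 + t * v.2) * ((starRingEnd ℂ) v.1 + t * (starRingEnd ℂ) v.2)) * hwc

theorem mom_expand {μ : Measure (ℂ × ℂ)} (hμ : IsSphereMeasure μ) (N : ℕ) (t : ℝ) :
    ∫ v : ℂ × ℂ, (v.1 + t * v.2) ^ N * ((starRingEnd ℂ) v.1 + t * (starRingEnd ℂ) v.2) ^ N ∂μ
      = ∑ i ∈ Finset.range (N + 1), (N.choose i : ℂ) ^ 2 * ((t : ℂ) ^ 2) ^ (N - i) *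
          mom μ i (N - i) i (N - i) := by
  have key : ∀ v : ℂ × ℂ,
      (v.1 + t * v.2) ^ N * ((starRingEnd ℂ) v.1 + t * (starRingEnd ℂ) v.2) ^ N =
      ∑ i ∈ Finset.range (N + 1), ∑ j ∈ Finset.range (N + 1),
        ((N.choose i : ℂ) * (N.choose j : ℂ) * (t : ℂ) ^ (N - i) * (t : ℂ) ^ (N - j)) *
        (v.1 ^ i * v.2 ^ (N - i) * (starRingEnd ℂ) v.1 ^ j * (starRingEnd ℂ) v.2 ^ (N - j)) := by
    intro v
    rw [add_pow, add_pow, Finset.sum_mul_sum]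
    refine Finset.sum_congr rfl fun i _ => Finset.sum_congr rfl fun j _ => ?_
    rw [mul_pow, mul_pow]; ring
  simp_rw [key]
  rw [integral_finsetSum _ fun i _ => integrable_finsetSum _ fun j _ =>
    (mom_int hμ _ _ _ _).const_mul _]
  refine Finset.sum_congr rfl fun i hi => ?_
  rw [integral_finsetSum _ fun j _ => (mom_int hμ _ _ _ _).const_mul _]
  rw [Finset.sum_eq_single i]
  · rw [integral_const_mul]
    unfold mom
    ring
  · intro j _ hj
    rw [integral_const_mul]
    have := mom_zero1 hμ i (N - i) j (N - j) hj.symm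
    unfold mom at this
    rw [this, mul_zero]
  · intro h; exact absurd hi h

theorem mom_choose {μ : Measure (ℂ × ℂ)} (hμ : IsSphereMeasure μ) (m n : ℕ) :
    ((m + n).choose n : ℂ) * mom μ m n m n = mom μ (m + n) 0 (m + n) 0 := by
  set N := m + n with hN
  set A : Polynomial ℂ := ∑ i ∈ Finset.range (N + 1),
    Polynomial.C ((N.choose i : ℂ) ^ 2 * mom μ i (N - i) i (N - i)) * Polynomial.X ^ (N - i)
  set B : Polynomial ℂ := (1 + Polynomial.X) ^ N * Polynomial.C (mom μ N 0 N 0)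
  have hAB : A = B := by
    refine Polynomial.eq_of_infinite_eval_eq A B ?_
    have hinj : Function.Injective (fun k : ℕ => ((k : ℂ)) ^ 2) := by
      intro x y hxy
      have : x ^ 2 = y ^ 2 := by
        dsimp only at hxy
        exact_mod_cast hxy
      exact Nat.pow_left_injective (n := 2) (by norm_num) this
    refine (Set.infinite_range_of_injective hinj).mono ?_
    rintro _ ⟨k, rfl⟩
    have h := (mom_expand hμ N (k : ℝ)).symm.trans (mom_rot hμ N (k : ℝ))
    simp only [Set.mem_setOf_eq, A, B, Polynomial.eval_finset_sum, Polynomial.eval_mul,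
      Polynomial.eval_C, Polynomial.eval_pow, Polynomial.eval_X, Polynomial.eval_add,
      Polynomial.eval_one]
    push_cast at h
    rw [← h]
    refine Finset.sum_congr rfl fun i _ => ?_
    ring
  have hc := congrArg (fun Q => Polynomial.coeff Q n) hAB
  simp only [A, B, Polynomial.finset_sum_coeff, Polynomial.coeff_C_mul, Polynomial.coeff_mul_C,
    Polynomial.coeff_one_add_X_pow, Polynomial.coeff_X_pow] at hc
  rw [Finset.sum_eq_single m] at hc
  · have e : N - m = n := by omega
    rw [e, if_pos rfl] at hc
    have e2 : N.choose m = N.choose n := Nat.choose_symm_add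
    rw [e2] at hc
    have hne : (N.choose n : ℂ) ≠ 0 := by
      exact_mod_cast (Nat.choose_pos (by omega : n ≤ N)).ne'
    apply mul_left_cancel₀ hne
    linear_combination hc
  · intro j hj hjm
    have := Finset.mem_range.mp hj
    rw [if_neg (by omega), mul_zero]
  · intro h; exact absurd (Finset.mem_range.mpr (by omega)) h

theorem mom_split {μ : Measure (ℂ × ℂ)} (hμ : IsSphereMeasure μ) (N : ℕ) :
    mom μ N 0 N 0 = mom μ (N + 1) 0 (N + 1) 0 + mom μ N 1 N 1 := by
  unfold mom
  rw [← integral_add (mom_int hμ _ _ _ _) (mom_int hμ _ _ _ _)]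
  refine integral_congr_ae ?_
  filter_upwards [sph_ae hμ] with v hv
  have h : v.1 * (starRingEnd ℂ) v.1 + v.2 * (starRingEnd ℂ) v.2 = 1 := by
    rw [Complex.mul_conj, Complex.mul_conj]; exact_mod_cast hv
  linear_combination (-(v.1 ^ N * (starRingEnd ℂ) v.1 ^ N)) * h

theorem mom_top {μ : Measure (ℂ × ℂ)} (hμ : IsSphereMeasure μ) (N : ℕ) :
    ((N : ℂ) + 1) * mom μ N 0 N 0 = mom μ 0 0 0 0 := by
  induction N with
  | zero => simp
  | succ N ih =>
    have h1 := mom_split hμ N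
    have h2 := mom_choose hμ N 1
    rw [Nat.choose_one_right] at h2
    push_cast at h2 ⊢
    rw [← ih]
    linear_combination (-(N : ℂ) - 1) * h1 - h2

theorem mom_formula {μ : Measure (ℂ × ℂ)} (hμ : IsSphereMeasure μ) (m n : ℕ) :
    ((m + n + 1).factorial : ℂ) * mom μ m n m n
      = (m.factorial : ℂ) * n.factorial * mom μ 0 0 0 0 := by
  have h1 := mom_choose hμ m n
  have h2 := mom_top hμ (m + n)
  have h3 : ((m + n).choose n : ℂ) * n.factorial * m.factorial = (m + n).factorial := by
    have := Nat.choose_mul_factorial_mul_factorial (Nat.le_add_left n m)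
    rw [Nat.add_sub_cancel] at this
    exact_mod_cast this
  rw [Nat.factorial_succ]
  push_cast at h2 ⊢
  rw [← h2, ← h1, ← h3]
  ring

/-- The orthogonal projection in `L²(S³,σ)` of the monomial `z₁^p z₂^q z̄₁^r z̄₂^s` onto the
closed linear span of the antiholomorphic monomials `{z̄₁^a z̄₂^b}`: the claimed formula `g`
lies in the span of the antiholomorphic monomials, and the difference is orthogonal (in the
`L²` inner product) to every antiholomorphic monomial. -/
theorem stmt_14 (μ : Measure (ℂ × ℂ)) (hμ : IsSphereMeasure μ) (p q r s : ℕ)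
    (g : ℂ × ℂ → ℂ)
    (hg : g = if p ≤ r ∧ q ≤ s then
        (fun v : ℂ × ℂ =>
          (((r.factorial * s.factorial * (r + s - p - q + 1).factorial : ℕ) : ℂ) /
            (((r + s + 1).factorial * (r - p).factorial * (s - q).factorial : ℕ) : ℂ)) *
          (starRingEnd ℂ) v.1 ^ (r - p) * (starRingEnd ℂ) v.2 ^ (s - q))
      else (0 : ℂ × ℂ → ℂ)) :
    g ∈ Submodule.span ℂ
        {m : ℂ × ℂ → ℂ | ∃ a b : ℕ,
          m = fun v => (starRingEnd ℂ) v.1 ^ a * (starRingEnd ℂ) v.2 ^ b} ∧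
    ∀ a b : ℕ,
      ∫ v : ℂ × ℂ,
          (v.1 ^ p * v.2 ^ q * (starRingEnd ℂ) v.1 ^ r * (starRingEnd ℂ) v.2 ^ s - g v) *
            (starRingEnd ℂ) ((starRingEnd ℂ) v.1 ^ a * (starRingEnd ℂ) v.2 ^ b) ∂μ = 0 := by
  have hG : ∃ C : ℂ, (g = fun v : ℂ × ℂ => C *
      (starRingEnd ℂ) v.1 ^ (r - p) * (starRingEnd ℂ) v.2 ^ (s - q)) ∧
      ∀ a b, mom μ (p + a) (q + b) r s = C * mom μ a b (r - p) (s - q) := by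
    by_cases hc : p ≤ r ∧ q ≤ s
    · rw [if_pos hc] at hg
      refine ⟨_, hg, fun a b => ?_⟩
      obtain ⟨h1, h2⟩ := hc
      by_cases ha : p + a = r
      · by_cases hb : q + b = s
        · subst ha hb
          have e1 : p + a - p = a := by omega
          have e2 : q + b - q = b := by omega
          have e3 : p + a + (q + b) - p - q + 1 = a + b + 1 := by omega
          rw [e1, e2, e3]
          have f1 := mom_formula hμ (p + a) (q + b)
          have f2 := mom_formula hμ a b
          have n1 : ((p + a + (q + b) + 1).factorial : ℂ) ≠ 0 := by
            exact_mod_cast Nat.factorial_ne_zero _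
          have n2 : (a.factorial : ℂ) ≠ 0 := by exact_mod_cast Nat.factorial_ne_zero _
          have n3 : (b.factorial : ℂ) ≠ 0 := by exact_mod_cast Nat.factorial_ne_zero _
          push_cast
          rw [div_mul_eq_mul_div, eq_div_iff (mul_ne_zero (mul_ne_zero n1 n2) n3)]
          linear_combination (a.factorial : ℂ) * b.factorial * f1 -
            ((p + a).factorial : ℂ) * (q + b).factorial * f2
        · rw [mom_zero2 hμ _ _ _ _ hb, mom_zero2 hμ _ _ _ _ (by omega), mul_zero]
      · rw [mom_zero1 hμ _ _ _ _ ha, mom_zero1 hμ _ _ _ _ (by omega), mul_zero]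
    · rw [if_neg hc] at hg
      refine ⟨0, by rw [hg]; ext v; simp, fun a b => ?_⟩
      rw [zero_mul]
      by_cases h : p + a = r
      · exact mom_zero2 hμ _ _ _ _ (by omega)
      · exact mom_zero1 hμ _ _ _ _ h
  obtain ⟨C, hgC, hC⟩ := hG
  clear hg
  subst hgC
  refine ⟨?_, fun a b => ?_⟩
  · have : (fun v : ℂ × ℂ => C * (starRingEnd ℂ) v.1 ^ (r - p) * (starRingEnd ℂ) v.2 ^ (s - q))
        = C • (fun v : ℂ × ℂ => (starRingEnd ℂ) v.1 ^ (r - p) * (starRingEnd ℂ) v.2 ^ (s - q)) := by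
      ext v; simp [mul_assoc]
    rw [this]
    exact Submodule.smul_mem _ _ (Submodule.subset_span ⟨_, _, rfl⟩)
  · have h := hC a b
    unfold mom at h
    rw [← sub_eq_zero, ← integral_const_mul, ← integral_sub (mom_int hμ _ _ _ _)
      ((mom_int hμ _ _ _ _).const_mul _)] at h
    rw [← h]
    congr 1
    ext v
    simp only [map_mul, map_pow, Complex.conj_conj]
    ring
end
end

section
/- For all natural numbers l ≤ k and all real numbers a, b: Σ_{i=l}^{k} C(i,l)·C(k,i)·(a)^{(i)}·(b)^{(k−i)} = C(k,l)·(a)^{(l)}·(a+b+l)^{(k−l)}. (Equivalently, Σ_{i=l}^{k} C(i,l)C(k,i)(a)^{(i)}(b)^{(k−i)} = C(k,l)·(a+b)^{(k)}/(a+b)^{(l)}·(a)^{(l)} whenever (a+b)^{(l)} ≠ 0.) -/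
open Finset

theorem chu_vandermonde_asc (n : ℕ) (a b : ℝ) :
    ∑ ij ∈ Finset.HasAntidiagonal.antidiagonal n, (n.choose ij.1 : ℝ) *
      ((ascPochhammer ℝ ij.1).eval a * (ascPochhammer ℝ ij.2).eval b) =
      (ascPochhammer ℝ n).eval (a + b) := by
  induction n with
  | zero => simp
  | succ n ih =>
    rw [Finset.sum_antidiagonal_choose_succ_mul
      (fun i j => (ascPochhammer ℝ i).eval a * (ascPochhammer ℝ j).eval b) n,
      ascPochhammer_succ_eval, ← ih, Finset.sum_mul, ← Finset.sum_add_distrib]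
    refine Finset.sum_congr rfl fun ij h => ?_
    have h1 := Finset.HasAntidiagonal.mem_antidiagonal.mp h
    have h2 : n.choose ij.2 = n.choose ij.1 := (Nat.choose_symm_of_eq_add h1.symm).symm
    rw [h2, ascPochhammer_succ_eval, ascPochhammer_succ_eval, ← h1]
    push_cast
    ring

/-- Generalized Chu–Vandermonde identity for ascending Pochhammer symbols: for `l ≤ k` and
real `a, b`, `Σ_{i=l}^{k} C(i,l)·C(k,i)·(a)^{(i)}·(b)^{(k−i)}
= C(k,l)·(a)^{(l)}·(a+b+l)^{(k−l)}`. -/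
theorem stmt_15 (k l : ℕ) (hlk : l ≤ k) (a b : ℝ) :
    ∑ i ∈ Finset.Icc l k,
        (i.choose l : ℝ) * (k.choose i : ℝ) *
          (ascPochhammer ℝ i).eval a * (ascPochhammer ℝ (k - i)).eval b =
      (k.choose l : ℝ) * (ascPochhammer ℝ l).eval a *
        (ascPochhammer ℝ (k - l)).eval (a + b + l) := by
  obtain ⟨n, rfl⟩ := Nat.exists_eq_add_of_le hlk
  have e : a + b + (l : ℝ) = (a + l) + b := by ring
  rw [Nat.add_sub_cancel_left, e, ← chu_vandermonde_asc,
    Finset.Nat.sum_antidiagonal_eq_sum_range_succ_mk, Finset.mul_sum,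
    ← Finset.Ico_add_one_right_eq_Icc, Finset.sum_Ico_eq_sum_range]
  have e2 : l + n + 1 - l = n.succ := by omega
  rw [e2]
  refine Finset.sum_congr rfl fun m hm => ?_
  have hm' : m ≤ n := Nat.lt_succ_iff.mp (Finset.mem_range.mp hm)
  have h3 : (l + n).choose (l + m) * (l + m).choose l = (l + n).choose l * n.choose m := by
    have := Nat.choose_mul (n := l + n) (k := l + m) (s := l) (by omega)
    simpa using this
  have h4 : (((l + n).choose (l + m) : ℝ)) * (l + m).choose l
      = (l + n).choose l * n.choose m := by exact_mod_cast h3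
  have h5 : (ascPochhammer ℝ (l + m)).eval a
      = (ascPochhammer ℝ l).eval a * (ascPochhammer ℝ m).eval (a + l) := by
    rw [← ascPochhammer_mul]; simp
  have h6 : l + n - (l + m) = n - m := by omega
  rw [h5, h6]
  linear_combination (ascPochhammer ℝ l).eval a * (ascPochhammer ℝ m).eval (a + l) *
    (ascPochhammer ℝ (n - m)).eval b * h4
end

section
/- For all natural numbers a, b, k with k ≤ a and k ≤ b, the following identity holds in ℚ: Σ_{i=0}^{k} C(k,i)·1/([a]_i·[b]_{k−i}) = [a+b−k+1]_k/([a]_k·[b]_k), where [a]_n = a!/(a−n)! is the descending factorial. -/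
open Finset

/-- For `k ≤ a` and `k ≤ b`,
`Σ_{i=0}^{k} C(k,i)/([a]_i·[b]_{k−i}) = [a+b−k+1]_k/([a]_k·[b]_k)` in `ℚ`,
where `[a]_n = a!/(a−n)!` is the descending factorial. -/
theorem stmt_16 (a b k : ℕ) (hka : k ≤ a) (hkb : k ≤ b) :
    ∑ i ∈ Finset.range (k + 1),
        (k.choose i : ℚ) / ((a.descFactorial i : ℚ) * (b.descFactorial (k - i) : ℚ)) =
      ((a + b - k + 1).descFactorial k : ℚ) /
        ((a.descFactorial k : ℚ) * (b.descFactorial k : ℚ)) := by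
  induction k generalizing a b with
  | zero => simp
  | succ k ih =>
    obtain ⟨p, rfl⟩ : ∃ p, a = p + 1 := ⟨a - 1, by omega⟩
    obtain ⟨q, rfl⟩ : ∃ q, b = q + 1 := ⟨b - 1, by omega⟩
    have h := Finset.sum_choose_succ_mul
      (fun i j => (1 : ℚ) / (((p+1).descFactorial i : ℚ) * ((q+1).descFactorial j : ℚ))) k
    simp only [mul_one_div] at h
    rw [h]
    have h1 := ih (p + 1) q (by omega) (by omega)
    have h2 := ih p (q + 1) (by omega) (by omega)
    have e1 : ∑ i ∈ Finset.range (k + 1), (k.choose i : ℚ) /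
        (((p+1).descFactorial i : ℚ) * ((q+1).descFactorial (k + 1 - i) : ℚ)) =
        (∑ i ∈ Finset.range (k + 1), (k.choose i : ℚ) /
        (((p+1).descFactorial i : ℚ) * (q.descFactorial (k - i) : ℚ))) / ((q : ℚ) + 1) := by
      rw [Finset.sum_div]
      refine Finset.sum_congr rfl fun i hi => ?_
      have hi' : k + 1 - i = (k - i) + 1 := by
        have := Finset.mem_range.1 hi
        omega
      rw [hi', Nat.succ_descFactorial_succ, div_div]
      push_cast
      congr 1
      ring
    have e2 : ∑ i ∈ Finset.range (k + 1), (k.choose i : ℚ) /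
        (((p+1).descFactorial (i + 1) : ℚ) * ((q+1).descFactorial (k - i) : ℚ)) =
        (∑ i ∈ Finset.range (k + 1), (k.choose i : ℚ) /
        ((p.descFactorial i : ℚ) * ((q+1).descFactorial (k - i) : ℚ))) / ((p : ℚ) + 1) := by
      rw [Finset.sum_div]
      refine Finset.sum_congr rfl fun i hi => ?_
      rw [Nat.succ_descFactorial_succ, div_div]
      push_cast
      congr 1
      ring
    rw [e1, e2, h1, h2]
    obtain ⟨r, rfl⟩ : ∃ r, p = k + r := ⟨p - k, by omega⟩
    obtain ⟨s, rfl⟩ : ∃ s, q = k + s := ⟨q - k, by omega⟩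
    have n1 : k + r + 1 + (k + s) - k + 1 = k + r + s + 2 := by omega
    have n2 : k + r + (k + s + 1) - k + 1 = k + r + s + 2 := by omega
    have n3 : k + r + 1 + (k + s + 1) - (k + 1) + 1 = k + r + s + 2 := by omega
    rw [n1, n2, n3]
    have d0 : (((k + r + s + 2).descFactorial (k + 1) : ℕ) : ℚ) =
        ((r : ℚ) + s + 2) * ((k + r + s + 2).descFactorial k : ℚ) := by
      rw [Nat.descFactorial_succ, show k + r + s + 2 - k = r + s + 2 by omega]
      push_cast; ring
    have key : ∀ t : ℕ, (((k + t + 1).descFactorial (k + 1) : ℕ) : ℚ) =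
        ((t : ℚ) + 1) * ((k + t + 1).descFactorial k : ℚ) := by
      intro t
      rw [Nat.descFactorial_succ, show k + t + 1 - k = t + 1 by omega]
      push_cast; ring
    have key2 : ∀ t : ℕ, (((k + t + 1).descFactorial (k + 1) : ℕ) : ℚ) =
        ((k : ℚ) + t + 1) * ((k + t).descFactorial k : ℚ) := by
      intro t
      rw [Nat.succ_descFactorial_succ]
      push_cast; ring
    have pos : ∀ t : ℕ, (((k + t).descFactorial k : ℕ) : ℚ) ≠ 0 := by
      intro t
      exact_mod_cast (Nat.descFactorial_pos.2 (Nat.le_add_right k t)).ne'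
    have val : ∀ t : ℕ, (((k + t + 1).descFactorial k : ℕ) : ℚ) =
        ((k : ℚ) + t + 1) * ((k + t).descFactorial k : ℚ) / ((t : ℚ) + 1) := by
      intro t
      rw [eq_div_iff (by positivity), ← key2, key]; ring
    rw [d0, key2, key2, val, val]
    have := pos r
    have := pos s
    have a1 : (k : ℚ) + r + 1 ≠ 0 := by positivity
    have a2 : (k : ℚ) + s + 1 ≠ 0 := by positivity
    have a3 : (r : ℚ) + 1 ≠ 0 := by positivity
    have a4 : (s : ℚ) + 1 ≠ 0 := by positivity
    push_cast
    field_simp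
    ring
end
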